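/- arXiv:math/0509633 — 2 statements merged into one kernel-verified Lean document; each statement's English description precedes it below -/
import Mathlib

section
/- Let κ be a singular cardinal of countable cofinality with κ > ℵ₁, and for each ordinal η < κ⁺ of cofinality ω₁ let C_η ⊆ η be a club in η of order type ω₁. Then for every pair of ordinals δ, β < κ⁺ there exists a family (K(n) : n < ω) of subsets of δ such that: (i) |K(n)| < κ for all n; (ii) K(n) ⊆ K(m) whenever n ≤ m; (iii) δ = ⋃_{n<ω} K(n); (iv) for every η < β of cofinality ω₁ there is n with C_η ∩ δ ⊆ K(n); and (v) each K(n) is a closed subset of δ, i.e., the supremum of every nonempty subset of K(n) that is bounded strictly below δ belongs to K(n). -/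
open Cardinal Ordinal

universe u

/-- `C` is a club in the ordinal `η`: `C ⊆ η`, `C` is unbounded in `η`, and the
supremum of every nonempty subset of `C` bounded strictly below `η` belongs to `C`. -/
def IsClubIn (C : Set Ordinal.{u}) (η : Ordinal.{u}) : Prop :=
  C ⊆ Set.Iio η ∧ (∀ a < η, ∃ b ∈ C, a ≤ b) ∧
    ∀ s ⊆ C, s.Nonempty → sSup s < η → sSup s ∈ C

/-- The order type of a set of ordinals. -/
noncomputable def setOrdType (C : Set Ordinal.{u}) : Ordinal.{u + 1} :=
  Ordinal.type ((· < ·) : C → C → Prop)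

open Set in
/-- Every ordinal below `κ⁺` is an increasing union of `ω` many sets of size `< κ`,
if `κ` has countable cofinality. -/
theorem exists_monotone_iUnion_eq_Iio {κ : Cardinal.{u}} (hκ : ℵ₀ ≤ κ)
    (hcof : κ.ord.cof = ℵ₀) {δ : Ordinal.{u}} (hδ : δ < (Order.succ κ).ord) :
    ∃ D : ℕ → Set Ordinal.{u}, Monotone D ∧ (⋃ n, D n) = Iio δ ∧
      ∀ n, #(D n) < Cardinal.lift.{u + 1} κ := by
  obtain ⟨S, hS, hSc⟩ := Order.exists_cof_eq κ.ord.ToType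
  rw [Ordinal.cof_toType, hcof] at hSc
  obtain ⟨e⟩ := Cardinal.eq.1 hSc
  have hδ' : δ.card ≤ κ := Order.lt_succ_iff.1 (Cardinal.lt_ord.1 hδ)
  have hle : Cardinal.lift.{u} #(Iio δ) ≤ Cardinal.lift.{u + 1} #κ.ord.ToType := by
    rw [Cardinal.mk_Iio_ordinal, Cardinal.lift_lift, Cardinal.mk_toType, Cardinal.card_ord]
    exact Cardinal.lift_le.2 hδ'
  obtain ⟨f⟩ := Cardinal.lift_mk_le'.1 hle
  let g : ℕ → κ.ord.ToType := fun n => (e.symm ⟨n⟩ : S)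
  refine ⟨fun n => Subtype.val '' (f ⁻¹' Iic (partialSups g n)), ?_, ?_, fun n => ?_⟩
  · exact fun m n h => image_mono (preimage_mono (Iic_subset_Iic.2 ((partialSups g).mono h)))
  · ext x
    simp only [mem_iUnion, mem_image, mem_preimage, mem_Iic]
    constructor
    · rintro ⟨n, y, -, rfl⟩
      exact y.2
    · intro hx
      obtain ⟨s, hs, hxs⟩ := hS (f ⟨x, hx⟩)
      refine ⟨(e ⟨s, hs⟩).down, ⟨x, hx⟩, hxs.trans ?_, rfl⟩
      refine le_trans (le_of_eq ?_) (le_partialSups g _)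
      exact (congrArg Subtype.val (e.symm_apply_apply ⟨s, hs⟩)).symm
  · rw [Cardinal.mk_image_eq Subtype.val_injective]
    have h1 := Cardinal.mk_preimage_of_injective_lift f (Iic (partialSups g n)) f.injective
    have h2 : #(Iic (partialSups g n)) < κ := by
      have := Cardinal.mk_Iic_lt (partialSups g n) (by simp) (by simpa using hκ)
      simpa using this
    rw [Cardinal.lift_id'.{u, u + 1}] at h1
    exact h1.trans_lt (Cardinal.lift_lt.2 h2)

open Set in
/-- Passing to the closure adds at most one point for each point of the set, plus one. -/
theorem mk_closure_le (A : Set Ordinal.{u}) : #(closure A) ≤ #A + (#A + 1) := by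
  have hgap : ∀ x ∈ closure A \ A, ∀ y < x, ∃ a ∈ A, y < a ∧ a < x := by
    rintro x ⟨hx, hxA⟩ y hy
    have h := ((Ordinal.mem_closure_tfae x A).out 0 2).1 hx
    obtain ⟨a, ha, hya⟩ := exists_lt_of_lt_csSup h.1 (h.2.symm ▸ hy)
    exact ⟨a, ha.1, hya, lt_of_le_of_ne ha.2 fun h => hxA (h ▸ ha.1)⟩
  classical
  let f : ↥(closure A \ A) → Option A := fun x =>
    if h : (A ∩ Ici x.1).Nonempty then some ⟨sInf (A ∩ Ici x.1), (csInf_mem h).1⟩ else none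
  have hlt : ∀ x y : ↥(closure A \ A), x < y → f x ≠ f y := by
    intro x y hxy he
    obtain ⟨a, ha, hxa, hay⟩ := hgap y y.2 x hxy
    have hx : (A ∩ Ici x.1).Nonempty := ⟨a, ha, hxa.le⟩
    by_cases hy : (A ∩ Ici y.1).Nonempty
    · simp only [f, dif_pos hx, dif_pos hy, Option.some.injEq, Subtype.mk.injEq] at he
      have h1 : sInf (A ∩ Ici x.1) ≤ a := csInf_le' ⟨ha, hxa.le⟩
      have h2 : y.1 ≤ sInf (A ∩ Ici y.1) := (csInf_mem hy).2
      exact absurd (h2.trans (he ▸ h1)) (not_le.2 hay)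
    · simp [f, dif_pos hx, dif_neg hy] at he
  have hf : Function.Injective f := fun x y he => by
    rcases lt_trichotomy x y with h | h | h
    · exact absurd he (hlt x y h)
    · exact h
    · exact absurd he.symm (hlt y x h)
  calc #(closure A) ≤ #(A ∪ (closure A \ A) : Set Ordinal.{u}) :=
        Cardinal.mk_le_mk_of_subset (by simp)
    _ ≤ #A + #↥(closure A \ A) := Cardinal.mk_union_le _ _
    _ ≤ #A + (#A + 1) := by
        gcongr
        exact (Cardinal.mk_le_of_injective hf).trans (by simp)

/-- Let `κ > ℵ₁` be a singular cardinal of countable cofinality and, for each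
`η < κ⁺` of cofinality `ω₁`, let `C η ⊆ η` be a club in `η` of order type `ω₁`.
Then for all ordinals `δ, β < κ⁺` there is a family `(K n : n < ω)` of subsets of
`δ` which is increasing, has union `δ`, consists of closed sets of cardinality
`< κ`, and absorbs each trace `C η ∩ δ` for `η < β` of cofinality `ω₁`. -/
theorem exists_filtration_of_countable_cof (κ : Cardinal.{u}) (hκ : aleph 1 < κ)
    (hcof : κ.ord.cof = ℵ₀)
    (C : Ordinal.{u} → Set Ordinal.{u})
    (hC : ∀ η < (Order.succ κ).ord, η.cof = aleph 1 →
      IsClubIn (C η) η ∧ setOrdType (C η) = (aleph 1).ord)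
    (δ β : Ordinal.{u}) (hδ : δ < (Order.succ κ).ord) (hβ : β < (Order.succ κ).ord) :
    ∃ K : ℕ → Set Ordinal.{u},
      (∀ n, K n ⊆ Set.Iio δ) ∧
      (∀ n, #(K n) < Cardinal.lift.{u + 1} κ) ∧
      (∀ n m : ℕ, n ≤ m → K n ⊆ K m) ∧
      (⋃ n, K n) = Set.Iio δ ∧
      (∀ η < β, η.cof = aleph 1 → ∃ n, C η ∩ Set.Iio δ ⊆ K n) ∧
      (∀ n, ∀ s ⊆ K n, s.Nonempty → sSup s < δ → sSup s ∈ K n) := by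
  have hκ0 : ℵ₀ ≤ κ := (Cardinal.aleph0_le_aleph 1).trans hκ.le
  obtain ⟨D, hDm, hDU, hDc⟩ := exists_monotone_iUnion_eq_Iio hκ0 hcof hδ
  obtain ⟨B, hBm, hBU, hBc⟩ := exists_monotone_iUnion_eq_Iio hκ0 hcof hβ
  have hκ' : ℵ₀ ≤ Cardinal.lift.{u + 1} κ := by simpa using hκ0
  let E : ℕ → Set Ordinal.{u} := fun n => {η ∈ B n | η.cof = aleph 1}
  let A : ℕ → Set Ordinal.{u} := fun n => D n ∪ ⋃ η ∈ E n, C η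
  have hAm : Monotone A := fun m n h => Set.union_subset_union (hDm h)
    (Set.biUnion_subset_biUnion_left fun η hη => ⟨hBm h hη.1, hη.2⟩)
  have hCc : ∀ n, ∀ η ∈ E n, #(C η) = aleph 1 := by
    rintro n η ⟨hη, hc⟩
    have hηβ : η < β := by
      rw [← Set.mem_Iio, ← hBU]
      exact Set.mem_iUnion.2 ⟨n, hη⟩
    have h := congrArg Ordinal.card (hC η (hηβ.trans hβ) hc).2
    rwa [setOrdType, Ordinal.card_type, Cardinal.card_ord] at h
  have hAc : ∀ n, #(A n) < Cardinal.lift.{u + 1} κ := by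
    intro n
    have hE : #(E n) < Cardinal.lift.{u + 1} κ :=
      (Cardinal.mk_le_mk_of_subset (Set.sep_subset _ _)).trans_lt (hBc n)
    have hω : aleph 1 < Cardinal.lift.{u + 1} κ := by
      simpa using Cardinal.lift_lt.{u, u + 1}.2 hκ
    refine (Cardinal.mk_union_le _ _).trans_lt (Cardinal.add_lt_of_lt hκ' (hDc n) ?_)
    refine (Cardinal.mk_biUnion_le C (E n)).trans_lt (Cardinal.mul_lt_of_lt hκ' hE ?_)
    exact (ciSup_le' fun η : E n => (hCc n η η.2).le).trans_lt hω
  refine ⟨fun n => closure (A n) ∩ Set.Iio δ, fun n => Set.inter_subset_right, fun n => ?_,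
    fun n m h => Set.inter_subset_inter_left _ (closure_mono (hAm h)), ?_, fun η hη hc => ?_,
    fun n s hs hne hlt => ⟨?_, hlt⟩⟩
  · refine (Cardinal.mk_le_mk_of_subset Set.inter_subset_left).trans_lt
      ((mk_closure_le (A n)).trans_lt ?_)
    exact Cardinal.add_lt_of_lt hκ' (hAc n)
      (Cardinal.add_lt_of_lt hκ' (hAc n) (Cardinal.one_lt_aleph0.trans_le hκ'))
  · refine Set.Subset.antisymm (Set.iUnion_subset fun n => Set.inter_subset_right) fun x hx => ?_
    obtain ⟨n, hn⟩ := Set.mem_iUnion.1 (hDU.symm ▸ hx : x ∈ ⋃ n, D n)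
    exact Set.mem_iUnion.2 ⟨n, subset_closure (Or.inl hn), hx⟩
  · obtain ⟨n, hn⟩ := Set.mem_iUnion.1 (hBU.symm ▸ hη : η ∈ ⋃ n, B n)
    refine ⟨n, Set.inter_subset_inter_left _ (Set.Subset.trans ?_ subset_closure)⟩
    exact fun x hx => Or.inr (Set.mem_biUnion (show η ∈ E n from ⟨hn, hc⟩) hx)
  · exact closure_minimal (fun x hx => (hs hx).1) isClosed_closure
      (csSup_mem_closure hne ⟨δ, fun x hx => (hs hx).2.le⟩)
end

section
/- Let κ be an uncountable cardinal, and for each ordinal η < κ⁺ of uncountable cofinality let E_η ⊆ η be a club in η of minimal order type (i.e., of order type cof(η)). Then for every pair of ordinals δ, β < κ⁺ there exists a family (K(α) : α < κ) of subsets of δ such that: (i) |K(α)| < κ for all α < κ; (ii) K(α) ⊆ K(γ) whenever α ≤ γ; (iii) δ = ⋃_{α<κ} K(α); (iv) for every η < β of uncountable cofinality with |E_η ∩ δ| < κ there is α < κ with E_η ∩ δ ⊆ K(α); and (v) each K(α) is a closed subset of δ, i.e., the supremum of every nonempty subset of K(α) that is bounded strictly below δ belongs to K(α). -/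
open Cardinal Ordinal

universe u

/-- The points below `δ` that are `0`, members of `A`, or limits of members of `A`. -/
def closureBelow (A : Set Ordinal.{u}) (δ : Ordinal.{u}) : Set Ordinal.{u} :=
  {x | x < δ ∧ ∀ y < x, ∃ a ∈ A, y < a ∧ a ≤ x}

theorem subset_closureBelow {A : Set Ordinal.{u}} {δ : Ordinal.{u}} (hA : A ⊆ Set.Iio δ) :
    A ⊆ closureBelow A δ :=
  fun x hx => ⟨hA hx, fun _ hy => ⟨x, hx, hy, le_rfl⟩⟩

theorem closureBelow_mono {A B : Set Ordinal.{u}} (δ : Ordinal.{u}) (h : A ⊆ B) :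
    closureBelow A δ ⊆ closureBelow B δ := by
  rintro x ⟨hx, hlim⟩
  refine ⟨hx, fun y hy => ?_⟩
  obtain ⟨a, ha, hya⟩ := hlim y hy
  exact ⟨a, h ha, hya⟩

theorem sSup_mem_closureBelow {A s : Set Ordinal.{u}} {δ : Ordinal.{u}}
    (hs : s ⊆ closureBelow A δ) (hne : s.Nonempty) (hlt : sSup s < δ) :
    sSup s ∈ closureBelow A δ := by
  refine ⟨hlt, fun y hy => ?_⟩
  obtain ⟨z, hz, hyz⟩ := exists_lt_of_lt_csSup hne hy
  obtain ⟨a, ha, hya, haz⟩ := (hs hz).2 y hyz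
  exact ⟨a, ha, hya, haz.trans (le_csSup ⟨δ, fun _ hx => (hs hx).1.le⟩ hz)⟩

/-- Sending a point of the closure to the next member of `insert δ A` is injective. -/
theorem mk_closureBelow_le (A : Set Ordinal.{u}) (δ : Ordinal.{u}) :
    #(closureBelow A δ) ≤ #A + 1 := by
  let next : Ordinal.{u} → Ordinal.{u} := fun x => sInf {a | a ∈ insert δ A ∧ x < a}
  have next_mem {x} (hx : x ∈ closureBelow A δ) : next x ∈ insert δ A ∧ x < next x :=
    csInf_mem (s := {a | a ∈ insert δ A ∧ x < a}) ⟨δ, Set.mem_insert _ _, hx.1⟩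
  have hmono : StrictMonoOn next (closureBelow A δ) := by
    intro x _ y hy hxy
    obtain ⟨a, ha, hxa, hay⟩ := hy.2 x hxy
    have hle : next x ≤ a := csInf_le' ⟨Set.mem_insert_of_mem _ ha, hxa⟩
    exact (hle.trans hay).trans_lt (next_mem hy).2
  calc #(closureBelow A δ) ≤ #(insert δ A : Set Ordinal.{u}) := by
        rw [← mk_image_eq_of_injOn _ _ hmono.injOn]
        refine mk_le_mk_of_subset ?_
        rintro _ ⟨x, hx, rfl⟩
        exact (next_mem hx).1
    _ ≤ #A + 1 := mk_insert_le

theorem exists_injOn_mapsTo_Iio_ord {κ : Cardinal.{u}} {δ : Ordinal.{u}}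
    (hδ : δ < (Order.succ κ).ord) :
    ∃ g : Ordinal.{u} → Ordinal.{u},
      Set.InjOn g (Set.Iio δ) ∧ Set.MapsTo g (Set.Iio δ) (Set.Iio κ.ord) := by
  have hle : #(Set.Iio δ) ≤ #(Set.Iio κ.ord) := by
    rw [Cardinal.mk_Iio_ordinal, Cardinal.mk_Iio_ordinal, card_ord, Cardinal.lift_le]
    exact Order.lt_succ_iff.mp (lt_ord.mp hδ)
  obtain ⟨f⟩ := Cardinal.le_def _ _ |>.mp hle
  classical
  refine ⟨fun x => if h : x < δ then f ⟨x, h⟩ else 0, fun x hx y hy hxy => ?_, fun x hx => ?_⟩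
  · simp only [Set.mem_Iio] at hx hy
    simp only [hx, hy, dif_pos] at hxy
    exact congrArg Subtype.val (f.injective (Subtype.ext hxy))
  · simp only [Set.mem_Iio] at hx
    simp only [hx, dif_pos]
    exact (f ⟨x, hx⟩).2

theorem mk_sep_lt_le_of_injOn {g : Ordinal.{u} → Ordinal.{u}} {s : Set Ordinal.{u}}
    (hg : Set.InjOn g s) (α : Ordinal.{u}) :
    #{x ∈ s | g x < α} ≤ Cardinal.lift.{u + 1} α.card := by
  rw [← Cardinal.mk_Iio_ordinal, ← mk_image_eq_of_injOn g _ (hg.mono (Set.sep_subset _ _))]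
  refine mk_le_mk_of_subset ?_
  rintro _ ⟨x, hx, rfl⟩
  exact hx.2

/-- Let `κ` be an uncountable cardinal and, for each `η < κ⁺` of uncountable
cofinality, let `E η ⊆ η` be a club in `η` of minimal order type (i.e. of order
type `cof η`). Then for all ordinals `δ, β < κ⁺` there is a family
`(K α : α < κ)` of subsets of `δ` which is increasing, has union `δ`, consists
of closed sets of cardinality `< κ`, and absorbs each trace `E η ∩ δ` of
cardinality `< κ` for `η < β` of uncountable cofinality. -/
theorem exists_filtration_of_uncountable (κ : Cardinal.{u}) (hκ : ℵ₀ < κ)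
    (E : Ordinal.{u} → Set Ordinal.{u})
    (hE : ∀ η < (Order.succ κ).ord, ℵ₀ < η.cof →
      IsClubIn (E η) η ∧ setOrdType (E η) = Ordinal.lift.{u + 1} (η.cof).ord)
    (δ β : Ordinal.{u}) (hδ : δ < (Order.succ κ).ord) (hβ : β < (Order.succ κ).ord) :
    ∃ K : Ordinal.{u} → Set Ordinal.{u},
      (∀ α < κ.ord, K α ⊆ Set.Iio δ) ∧
      (∀ α < κ.ord, #(K α) < Cardinal.lift.{u + 1} κ) ∧
      (∀ α γ : Ordinal.{u}, α ≤ γ → γ < κ.ord → K α ⊆ K γ) ∧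
      (⋃ α ∈ Set.Iio κ.ord, K α) = Set.Iio δ ∧
      (∀ η < β, ℵ₀ < η.cof → #(E η ∩ Set.Iio δ : Set Ordinal.{u}) < Cardinal.lift.{u + 1} κ →
        ∃ α < κ.ord, E η ∩ Set.Iio δ ⊆ K α) ∧
      (∀ α < κ.ord, ∀ s ⊆ K α, s.Nonempty → sSup s < δ → sSup s ∈ K α) := by
  obtain ⟨g, hgi, hgm⟩ := exists_injOn_mapsTo_Iio_ord hδ
  obtain ⟨h, hhi, hhm⟩ := exists_injOn_mapsTo_Iio_ord hβ
  let I : Ordinal.{u} → Set Ordinal.{u} := fun α =>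
    {η ∈ {η ∈ Set.Iio β | h η < α} |
      #(E η ∩ Set.Iio δ : Set Ordinal.{u}) ≤ Cardinal.lift.{u + 1} α.card}
  let A : Ordinal.{u} → Set Ordinal.{u} := fun α =>
    {x ∈ Set.Iio δ | g x < α} ∪ ⋃ η ∈ I α, E η ∩ Set.Iio δ
  have hAδ (α) : A α ⊆ Set.Iio δ :=
    Set.union_subset (Set.sep_subset _ _) (Set.iUnion₂_subset fun _ _ => Set.inter_subset_right)
  have hAmono {α γ : Ordinal.{u}} (hαγ : α ≤ γ) : A α ⊆ A γ := by
    refine Set.union_subset_union (fun x hx => ⟨hx.1, hx.2.trans_le hαγ⟩)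
      (Set.biUnion_subset_biUnion_left fun η hη => ⟨⟨hη.1.1, hη.1.2.trans_le hαγ⟩, ?_⟩)
    exact hη.2.trans (Cardinal.lift_le.mpr (Ordinal.card_le_card hαγ))
  have hlim : Order.IsSuccLimit κ.ord := isSuccLimit_ord hκ.le
  have hκ' : ℵ₀ ≤ Cardinal.lift.{u + 1} κ := aleph0_le_lift.mpr hκ.le
  have hAcard {α : Ordinal.{u}} (hα : α < κ.ord) : #(A α) < Cardinal.lift.{u + 1} κ := by
    have hακ : Cardinal.lift.{u + 1} α.card < Cardinal.lift.{u + 1} κ :=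
      Cardinal.lift_lt.mpr (lt_ord.mp hα)
    have hI : #(I α) ≤ Cardinal.lift.{u + 1} α.card :=
      (mk_le_mk_of_subset (Set.sep_subset _ _)).trans (mk_sep_lt_le_of_injOn hhi α)
    refine (mk_union_le _ _).trans_lt (add_lt_of_lt hκ'
      ((mk_sep_lt_le_of_injOn hgi α).trans_lt hακ) ?_)
    refine lt_of_le_of_lt ?_ (mul_lt_of_lt hκ' hακ hακ)
    exact (mk_biUnion_le _ _).trans (mul_le_mul' hI (ciSup_le' fun η => η.2.2))
  refine ⟨fun α => closureBelow (A α) δ, fun α _ x hx => hx.1, fun α hα => ?_,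
    fun α γ hαγ _ => closureBelow_mono δ (hAmono hαγ), ?_, fun η hη _ hcard => ?_,
    fun α _ s hs hne hlt => sSup_mem_closureBelow hs hne hlt⟩
  · exact (mk_closureBelow_le _ _).trans_lt
      (add_lt_of_lt hκ' (hAcard hα) (one_lt_aleph0.trans_le hκ'))
  · refine Set.Subset.antisymm (Set.iUnion₂_subset fun _ _ x hx => hx.1) fun x hx => ?_
    exact Set.mem_biUnion (hlim.succ_lt (hgm hx))
      (subset_closureBelow (hAδ _) (Or.inl ⟨hx, Order.lt_succ _⟩))
  · obtain ⟨c, hcκ, hc⟩ := lt_lift_iff.mp hcard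
    refine ⟨max (Order.succ (h η)) c.ord, max_lt (hlim.succ_lt (hhm hη)) (ord_lt_ord.mpr hcκ), ?_⟩
    refine Set.Subset.trans (fun x hx => Or.inr (Set.mem_biUnion (x := η) ?_ hx))
      (subset_closureBelow (hAδ _))
    refine ⟨⟨hη, (Order.lt_succ _).trans_le (le_max_left _ _)⟩, ?_⟩
    rw [← hc, Cardinal.lift_le, ← ord_le]
    exact le_max_right _ _
end
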